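/- Let k ≥ 3 and 1 ≤ n₁ ≤ ⋯ ≤ n_k. The 3-secant variety of the Segre variety P^{n₁} × ⋯ × P^{n_k} is non-defective, i.e. T(n₁,…,n_k; 3; 0,…,0) holds, unless (n₁,…,n_k) = (1,1,a) with a ≥ 3 or (n₁,…,n_k) = (1,1,1,1); in these exceptional cases T(n₁,…,n_k; 3; 0,…,0) fails. -/

import Mathlib

open scoped TensorProduct

/-- The subspace `G^i_p = v₁ ⊗ ⋯ ⊗ v_{i-1} ⊗ Vᵢ ⊗ v_{i+1} ⊗ ⋯ ⊗ v_k` of the tensor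
space `⨂ᵢ K^{nᵢ+1}` attached to the point `p = v₁ ⊗ ⋯ ⊗ v_k`. -/
noncomputable def segreG (K : Type*) [Field K] {k : ℕ} (n : Fin k → ℕ)
    (v : ∀ i, Fin (n i + 1) → K) (i : Fin k) :
    Submodule K (⨂[K] i, (Fin (n i + 1) → K)) :=
  LinearMap.range ((PiTensorProduct.tprod K).toLinearMap v i)

/-- The affine tangent space `T_p = Σᵢ v₁ ⊗ ⋯ ⊗ Vᵢ ⊗ ⋯ ⊗ v_k` to the Segre variety at
`p = v₁ ⊗ ⋯ ⊗ v_k`. -/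
noncomputable def segreTangent (K : Type*) [Field K] {k : ℕ} (n : Fin k → ℕ)
    (v : ∀ i, Fin (n i + 1) → K) : Submodule K (⨂[K] i, (Fin (n i + 1) → K)) :=
  ⨆ i, segreG K n v i

/-- The statement `T(n₁,…,n_k; s; a₁,…,a_k)` of Abo–Ottaviani–Peterson holds:
there are points `p₁,…,p_s` and `q_{i,1},…,q_{i,aᵢ}` (pure tensors of nonzero vectors)
such that the span of the tangent spaces `T_{p_j}` together with the subspaces
`G^i_{q_{i,l}}` has the expected (maximal possible) dimension
`min (s(1 + Σ nᵢ) + Σ aᵢ(nᵢ+1)) (Π (nᵢ+1))`. -/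
def THolds (K : Type*) [Field K] {k : ℕ} (n : Fin k → ℕ) (s : ℕ) (a : Fin k → ℕ) : Prop :=
  ∃ (p : Fin s → ∀ i, Fin (n i + 1) → K)
    (q : ∀ i : Fin k, Fin (a i) → ∀ j, Fin (n j + 1) → K),
    (∀ j i, p j i ≠ 0) ∧ (∀ i l j, q i l j ≠ 0) ∧
    Module.finrank K
      (((⨆ j, segreTangent K n (p j)) ⊔ (⨆ i, ⨆ l, segreG K n (q i l) i))
        : Submodule K (⨂[K] i, (Fin (n i + 1) → K)))
      = min (s * (1 + ∑ i, n i) + ∑ i, a i * (n i + 1)) (∏ i, (n i + 1))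

/-- The statement `T(n₁,…,n_k; s; a₁,…,a_k)` fails: every choice of points gives a span
of dimension strictly smaller than the expected dimension. -/
def TFails (K : Type*) [Field K] {k : ℕ} (n : Fin k → ℕ) (s : ℕ) (a : Fin k → ℕ) : Prop :=
  ∀ (p : Fin s → ∀ i, Fin (n i + 1) → K)
    (q : ∀ i : Fin k, Fin (a i) → ∀ j, Fin (n j + 1) → K),
    (∀ j i, p j i ≠ 0) → (∀ i l j, q i l j ≠ 0) →
    Module.finrank K
      (((⨆ j, segreTangent K n (p j)) ⊔ (⨆ i, ⨆ l, segreG K n (q i l) i))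
        : Submodule K (⨂[K] i, (Fin (n i + 1) → K)))
      < min (s * (1 + ∑ i, n i) + ∑ i, a i * (n i + 1)) (∏ i, (n i + 1))

/-- The tuple `(n; s; a)` is subabundant. -/
def Subabundant {k : ℕ} (n : Fin k → ℕ) (s : ℕ) (a : Fin k → ℕ) : Prop :=
  s * (1 + ∑ i, n i) + ∑ i, a i * (n i + 1) ≤ ∏ i, (n i + 1)

/-- The tuple `(n; s; a)` is superabundant. -/
def Superabundant {k : ℕ} (n : Fin k → ℕ) (s : ℕ) (a : Fin k → ℕ) : Prop :=
  ∏ i, (n i + 1) ≤ s * (1 + ∑ i, n i) + ∑ i, a i * (n i + 1)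

section LinearAlgebra

variable {K : Type*} [Field K]

/-- If a surjection `f : V → Y` maps `W` into `S`, then `W` has codimension at least that of `S`. -/
theorem finrank_add_le_of_le_comap {V Y : Type*} [AddCommGroup V] [Module K V]
    [FiniteDimensional K V] [AddCommGroup Y] [Module K Y] [FiniteDimensional K Y]
    (f : V →ₗ[K] Y) (hf : Function.Surjective f) (W : Submodule K V) (S : Submodule K Y)
    (h : W ≤ S.comap f) :
    Module.finrank K W + Module.finrank K Y ≤ Module.finrank K V + Module.finrank K S := by
  have h1 := LinearMap.finrank_range_add_finrank_ker f
  rw [LinearMap.range_eq_top.2 hf, finrank_top] at h1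
  have h2 := LinearMap.finrank_range_add_finrank_ker (f.domRestrict W)
  have h3 : Module.finrank K (LinearMap.range (f.domRestrict W)) ≤ Module.finrank K S := by
    apply Submodule.finrank_mono
    rintro _ ⟨w, rfl⟩
    exact h w.2
  have h4 : Module.finrank K (LinearMap.ker (f.domRestrict W)) ≤
      Module.finrank K (LinearMap.ker f) := by
    rw [← Submodule.finrank_map_subtype_eq]
    apply Submodule.finrank_mono
    rintro _ ⟨w, hw, rfl⟩
    exact hw
  omega

theorem finrank_ker_proj {m : ℕ} (d : Fin (m + 1)) :
    Module.finrank K (LinearMap.ker (LinearMap.proj d : (Fin (m + 1) → K) →ₗ[K] K)) = m := by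
  have h := LinearMap.finrank_range_add_finrank_ker
    (LinearMap.proj d : (Fin (m + 1) → K) →ₗ[K] K)
  rw [LinearMap.range_eq_top.2 (LinearMap.proj_surjective d)] at h
  simp at h
  omega

end LinearAlgebra

section Tangent

variable (K : Type*) [Field K] {k : ℕ} (n : Fin k → ℕ)

/-- The identification of the tensor space with arrays of coordinates. -/
noncomputable def tensorCoord :
    (⨂[K] i, (Fin (n i + 1) → K)) ≃ₗ[K] ((∀ i, Fin (n i + 1)) → K) :=
  (Basis.piTensorProduct fun i => Pi.basisFun K (Fin (n i + 1))).equivFun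

@[simp]
theorem tensorCoord_tprod (v : ∀ i, Fin (n i + 1) → K) (x : ∀ i, Fin (n i + 1)) :
    tensorCoord K n (PiTensorProduct.tprod K v) x = ∏ i, v i (x i) := by
  simp [tensorCoord]

instance finiteDimensional_tensor : FiniteDimensional K (⨂[K] i, (Fin (n i + 1) → K)) :=
  (tensorCoord K n).symm.finiteDimensional

theorem finrank_tensor :
    Module.finrank K (⨂[K] i, (Fin (n i + 1) → K)) = ∏ i, (n i + 1) := by
  rw [(tensorCoord K n).finrank_eq]
  simp

/-- Parameters for the tangent space at `v`: a multiple of `v` itself together with, for each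
factor, a tangent direction whose coordinate `d i` vanishes. -/
abbrev TangentParam (d : ∀ i, Fin (n i + 1)) : Type _ :=
  K × ∀ i, LinearMap.ker (LinearMap.proj (d i) : (Fin (n i + 1) → K) →ₗ[K] K)

theorem finrank_tangentParam (d : ∀ i, Fin (n i + 1)) :
    Module.finrank K (TangentParam K n d) = 1 + ∑ i, n i := by
  rw [Module.finrank_prod, Module.finrank_pi_fintype, Module.finrank_self]
  simp only [finrank_ker_proj]

/-- The parametrization of the tangent space at `v`. -/
noncomputable def segreTangentMap (v : ∀ i, Fin (n i + 1) → K) (d : ∀ i, Fin (n i + 1)) :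
    TangentParam K n d →ₗ[K] (⨂[K] i, (Fin (n i + 1) → K)) :=
  (LinearMap.toSpanSingleton K _ (PiTensorProduct.tprod K v)).coprod
    (∑ i, ((PiTensorProduct.tprod K).toLinearMap v i ∘ₗ Submodule.subtype _) ∘ₗ
      LinearMap.proj i)

variable {K n}

theorem segreTangentMap_apply (v : ∀ i, Fin (n i + 1) → K) (d : ∀ i, Fin (n i + 1))
    (c : TangentParam K n d) :
    segreTangentMap K n v d c = c.1 • PiTensorProduct.tprod K v +
      ∑ i, PiTensorProduct.tprod K (Function.update v i (c.2 i : Fin (n i + 1) → K)) := by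
  simp [segreTangentMap]

theorem tensorCoord_segreTangentMap (v : ∀ i, Fin (n i + 1) → K) (d : ∀ i, Fin (n i + 1))
    (c : TangentParam K n d) (x : ∀ i, Fin (n i + 1)) :
    tensorCoord K n (segreTangentMap K n v d c) x = c.1 * ∏ i, v i (x i) +
      ∑ i, (c.2 i : Fin (n i + 1) → K) (x i) * ∏ j ∈ Finset.univ.erase i, v j (x j) := by
  simp only [segreTangentMap_apply, map_add, map_smul, map_sum, Pi.add_apply, Pi.smul_apply,
    Finset.sum_apply, tensorCoord_tprod, smul_eq_mul]
  congr 1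
  refine Finset.sum_congr rfl fun i _ => ?_
  rw [← Finset.mul_prod_erase _ _ (Finset.mem_univ i), Function.update_self]
  congr 1
  refine Finset.prod_congr rfl fun j hj => ?_
  rw [Function.update_of_ne (Finset.ne_of_mem_erase hj)]

theorem tprod_update_mem_segreTangent (v : ∀ i, Fin (n i + 1) → K) (i : Fin k)
    (w : Fin (n i + 1) → K) :
    PiTensorProduct.tprod K (Function.update v i w) ∈ segreTangent K n v :=
  Submodule.mem_iSup_of_mem i ⟨w, rfl⟩

theorem range_segreTangentMap (hk : 0 < k) (v : ∀ i, Fin (n i + 1) → K) (d : ∀ i, Fin (n i + 1))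
    (hv : ∀ i, v i (d i) ≠ 0) :
    LinearMap.range (segreTangentMap K n v d) = segreTangent K n v := by
  apply le_antisymm
  · rintro _ ⟨c, rfl⟩
    rw [segreTangentMap_apply]
    refine add_mem (Submodule.smul_mem _ _ ?_) (sum_mem fun i _ => ?_)
    · simpa using tprod_update_mem_segreTangent v ⟨0, hk⟩ (v ⟨0, hk⟩)
    · exact tprod_update_mem_segreTangent v i _
  · refine iSup_le fun i => ?_
    rintro _ ⟨w, rfl⟩
    set t := w (d i) / v i (d i) with ht
    have hw : (w - t • v i) (d i) = 0 := by simp [ht, hv i]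
    refine ⟨(t, Pi.single i ⟨w - t • v i, hw⟩), ?_⟩
    have hs : ∑ j, PiTensorProduct.tprod K (Function.update v j
        ((Pi.single i ⟨w - t • v i, hw⟩ : ∀ i,
          LinearMap.ker (LinearMap.proj (d i) : (Fin (n i + 1) → K) →ₗ[K] K)) j :
            Fin (n j + 1) → K)) =
        PiTensorProduct.tprod K (Function.update v i (w - t • v i)) := by
      rw [Finset.sum_eq_single i]
      · simp
      · intro j _ hj
        rw [Pi.single_eq_of_ne hj]
        exact (PiTensorProduct.tprod K).map_update_zero v j
      · simp
    rw [segreTangentMap_apply, hs, MultilinearMap.map_update_sub, MultilinearMap.map_update_smul]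
    simp

theorem finrank_segreTangent_le (hk : 0 < k) (v : ∀ i, Fin (n i + 1) → K) (hv : ∀ i, v i ≠ 0) :
    Module.finrank K (segreTangent K n v) ≤ 1 + ∑ i, n i := by
  choose d hd using fun i => Function.ne_iff.1 (hv i)
  rw [← range_segreTangentMap hk v d hd, ← finrank_tangentParam K n d]
  exact LinearMap.finrank_range_le _

theorem finrank_segreTangents_le (hk : 0 < k) (p : Fin 3 → ∀ i, Fin (n i + 1) → K)
    (hp : ∀ j i, p j i ≠ 0) :
    Module.finrank K (⨆ j, segreTangent K n (p j) : Submodule K _) ≤ 3 * (1 + ∑ i, n i) := by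
  have hle := le_iSup fun j => segreTangent K n (p j)
  have h : (⨆ j, segreTangent K n (p j)) =
      segreTangent K n (p 0) ⊔ (segreTangent K n (p 1) ⊔ segreTangent K n (p 2)) := by
    apply le_antisymm
    · refine iSup_le fun j => ?_
      fin_cases j
      · exact le_sup_left
      · exact le_sup_left.trans le_sup_right
      · exact le_sup_right.trans le_sup_right
    · exact sup_le (hle 0) (sup_le (hle 1) (hle 2))
  rw [h]
  have h0 := finrank_segreTangent_le hk _ (hp 0)
  have h1 := finrank_segreTangent_le hk _ (hp 1)
  have h2 := finrank_segreTangent_le hk _ (hp 2)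
  have h3 := Submodule.finrank_add_le_finrank_add_finrank (segreTangent K n (p 0))
    (segreTangent K n (p 1) ⊔ segreTangent K n (p 2))
  have h4 := Submodule.finrank_add_le_finrank_add_finrank (segreTangent K n (p 1))
    (segreTangent K n (p 2))
  omega

theorem iSup_segreG_eq_bot (q : ∀ _ : Fin k, Fin 0 → ∀ j, Fin (n j + 1) → K) :
    (⨆ i, ⨆ l, segreG K n (q i l) i) = ⊥ := by
  simp

theorem tHolds_three_of_le (hk : 0 < k) (p : Fin 3 → ∀ i, Fin (n i + 1) → K)
    (hp : ∀ j i, p j i ≠ 0)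
    (h : min (3 * (1 + ∑ i, n i)) (∏ i, (n i + 1)) ≤
      Module.finrank K (⨆ j, segreTangent K n (p j) : Submodule K _)) :
    THolds K n 3 (fun _ => 0) := by
  refine ⟨p, fun _ l => l.elim0, hp, fun _ l => l.elim0, ?_⟩
  rw [iSup_segreG_eq_bot, sup_bot_eq]
  simp only [zero_mul, Finset.sum_const_zero, add_zero]
  refine le_antisymm (le_min (finrank_segreTangents_le hk p hp) ?_) h
  exact (Submodule.finrank_le _).trans (finrank_tensor K n).le

theorem tFails_three_of_lt
    (h : ∀ p : Fin 3 → ∀ i, Fin (n i + 1) → K, (∀ j i, p j i ≠ 0) →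
      Module.finrank K (⨆ j, segreTangent K n (p j) : Submodule K _) <
        min (3 * (1 + ∑ i, n i)) (∏ i, (n i + 1))) :
    TFails K n 3 (fun _ => 0) := by
  intro p q hp _
  rw [iSup_segreG_eq_bot, sup_bot_eq]
  simpa only [zero_mul, Finset.sum_const_zero, add_zero] using h p hp

end Tangent

section LowerBound

variable {K : Type*} [Field K] {k : ℕ} {n : Fin k → ℕ}

/-- The multi-indices `d` and `x` differ in at least two places. -/
def FarFrom (d x : ∀ i, Fin (n i + 1)) : Prop :=
  ∃ i j, i ≠ j ∧ x i ≠ d i ∧ x j ≠ d j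

theorem farFrom_of_not_farFrom (hk : 3 ≤ k) {d e x : ∀ i, Fin (n i + 1)} (hde : ∀ i, d i ≠ e i)
    (h : ¬ FarFrom d x) : FarFrom e x := by
  have key : ∀ i j, i ≠ j → x i = d i ∨ x j = d j := by
    intro i j hij
    by_contra! hc
    exact h ⟨i, j, hij, hc⟩
  have hne : ∀ i, x i = d i → x i ≠ e i := fun i hi => hi ▸ hde i
  let a : Fin k := ⟨0, by omega⟩
  let b : Fin k := ⟨1, by omega⟩
  let c : Fin k := ⟨2, by omega⟩
  have hab : a ≠ b := by simp [a, b]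
  have hac : a ≠ c := by simp [a, c]
  have hbc : b ≠ c := by simp [b, c]
  rcases key a b hab with ha | hb
  · rcases key b c hbc with hb | hc
    · exact ⟨a, b, hab, hne a ha, hne b hb⟩
    · exact ⟨a, c, hac, hne a ha, hne c hc⟩
  · rcases key a c hac with ha | hc
    · exact ⟨a, b, hab, hne a ha, hne b hb⟩
    · exact ⟨b, c, hbc, hne b hb, hne c hc⟩

variable (K) in
/-- The coordinate vectors with index `d i` in every factor. -/
def coordPoint (d : ∀ i, Fin (n i + 1)) : ∀ i, Fin (n i + 1) → K :=
  fun i => Pi.single (d i) 1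

theorem tensorCoord_segreTangentMap_of_farFrom {d x : ∀ i, Fin (n i + 1)} (h : FarFrom d x)
    (c : TangentParam K n d) :
    tensorCoord K n (segreTangentMap K n (coordPoint K d) d c) x = 0 := by
  obtain ⟨i, j, hij, hi, hj⟩ := h
  have hi' : coordPoint K d i (x i) = 0 := Pi.single_eq_of_ne hi _
  have hj' : coordPoint K d j (x j) = 0 := Pi.single_eq_of_ne hj _
  rw [tensorCoord_segreTangentMap, Finset.prod_eq_zero (Finset.mem_univ i) hi', mul_zero, zero_add]
  refine Finset.sum_eq_zero fun l _ => ?_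
  by_cases hl : l = i
  · subst hl
    rw [Finset.prod_eq_zero (Finset.mem_erase.2 ⟨hij.symm, Finset.mem_univ j⟩) hj', mul_zero]
  · rw [Finset.prod_eq_zero (Finset.mem_erase.2 ⟨Ne.symm hl, Finset.mem_univ i⟩) hi', mul_zero]

theorem tangentParam_coe_apply {d : ∀ i, Fin (n i + 1)} (c : TangentParam K n d) (i : Fin k) :
    (c.2 i : Fin (n i + 1) → K) (d i) = 0 :=
  (c.2 i).2

theorem tangentParam_eq_zero {d : ∀ i, Fin (n i + 1)} {c : TangentParam K n d} (h1 : c.1 = 0)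
    (h2 : ∀ i m, m ≠ d i → (c.2 i : Fin (n i + 1) → K) m = 0) : c = 0 := by
  refine Prod.ext h1 (funext fun i => Subtype.ext (funext fun m => ?_))
  by_cases hm : m = d i
  · rw [hm]
    exact tangentParam_coe_apply c i
  · exact h2 i m hm

theorem tangentParam_eq_zero_of_near {d : ∀ i, Fin (n i + 1)} {c : TangentParam K n d}
    (h : ∀ x, ¬ FarFrom d x →
      tensorCoord K n (segreTangentMap K n (coordPoint K d) d c) x = 0) : c = 0 := by
  have h1 : c.1 = 0 := by
    have := h d (by rintro ⟨i, -, -, hi, -⟩; exact hi rfl)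
    rw [tensorCoord_segreTangentMap] at this
    simpa [coordPoint, tangentParam_coe_apply] using this
  refine tangentParam_eq_zero h1 fun i m hm => ?_
  have := h (Function.update d i m) (by
    rintro ⟨a, b, hab, ha, hb⟩
    by_cases hai : a = i
    · exact hb (Function.update_of_ne (fun hbi => hab (hai.trans hbi.symm)) _ _)
    · exact ha (Function.update_of_ne hai _ _))
  rw [tensorCoord_segreTangentMap, h1, zero_mul, zero_add, Finset.sum_eq_single i] at this
  · rw [Function.update_self, Finset.prod_eq_one, mul_one] at this
    · exact this
    · intro j hj
      rw [Function.update_of_ne (Finset.ne_of_mem_erase hj)]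
      simp [coordPoint]
  · intro j _ hj
    rw [Function.update_of_ne hj, tangentParam_coe_apply, zero_mul]
  · simp

theorem range_segreTangentMap_coordPoint (hk : 0 < k) (d : ∀ i, Fin (n i + 1)) :
    LinearMap.range (segreTangentMap K n (coordPoint K d) d) =
      segreTangent K n (coordPoint K d) :=
  range_segreTangentMap hk _ _ fun i => by simp [coordPoint]

theorem le_finrank_segreTangents (hk : 3 ≤ k) {d e : ∀ i, Fin (n i + 1)} (hde : ∀ i, d i ≠ e i)
    (v : ∀ i, Fin (n i + 1) → K) {U : Type*} [AddCommGroup U] [Module K U]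
    [FiniteDimensional K U] (f : U →ₗ[K] (⨂[K] i, (Fin (n i + 1) → K)))
    (hf : ∀ u, f u ∈ segreTangent K n v)
    (hinj : ∀ u, (∀ x, FarFrom d x → FarFrom e x → tensorCoord K n (f u) x = 0) → u = 0) :
    2 * (1 + ∑ i, n i) + Module.finrank K U ≤
      Module.finrank K (⨆ j, segreTangent K n
        ((![coordPoint K d, coordPoint K e, v] : Fin 3 → ∀ i, Fin (n i + 1) → K) j) :
          Submodule K _) := by
  set p : Fin 3 → ∀ i, Fin (n i + 1) → K := ![coordPoint K d, coordPoint K e, v]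
  set g : (TangentParam K n d × TangentParam K n e) × U →ₗ[K] (⨂[K] i, (Fin (n i + 1) → K)) :=
    ((segreTangentMap K n (coordPoint K d) d).coprod
      (segreTangentMap K n (coordPoint K e) e)).coprod f with hg
  have hrange : LinearMap.range g ≤ ⨆ j, segreTangent K n (p j) := by
    have hmem : ∀ j, segreTangent K n (p j) ≤ ⨆ j, segreTangent K n (p j) := le_iSup _
    rintro _ ⟨⟨⟨a, b⟩, u⟩, rfl⟩
    simp only [hg, LinearMap.coprod_apply]
    refine add_mem (add_mem ?_ ?_) ?_
    · exact hmem 0 (range_segreTangentMap_coordPoint (K := K) (by omega) d ▸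
        LinearMap.mem_range_self _ a)
    · exact hmem 1 (range_segreTangentMap_coordPoint (K := K) (by omega) e ▸
        LinearMap.mem_range_self _ b)
    · exact hmem 2 (hf u)
  have hginj : Function.Injective g := by
    refine (injective_iff_map_eq_zero g).2 ?_
    rintro ⟨⟨a, b⟩, u⟩ h0
    simp only [hg, LinearMap.coprod_apply] at h0
    have hx : ∀ x, tensorCoord K n (segreTangentMap K n (coordPoint K d) d a) x +
        tensorCoord K n (segreTangentMap K n (coordPoint K e) e b) x +
        tensorCoord K n (f u) x = 0 := fun x => by
      simpa using congrFun (congrArg (tensorCoord K n) h0) x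
    have hu : u = 0 := hinj u fun x h1 h2 => by
      simpa [tensorCoord_segreTangentMap_of_farFrom h1,
        tensorCoord_segreTangentMap_of_farFrom h2] using hx x
    subst hu
    have ha : a = 0 := tangentParam_eq_zero_of_near fun x h1 => by
      simpa [tensorCoord_segreTangentMap_of_farFrom (farFrom_of_not_farFrom hk hde h1)]
        using hx x
    have hb : b = 0 := tangentParam_eq_zero_of_near fun x h1 => by
      simpa [tensorCoord_segreTangentMap_of_farFrom
        (farFrom_of_not_farFrom hk (fun i => (hde i).symm) h1)] using hx x
    rw [ha, hb]
    rfl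
  have h1 := LinearMap.finrank_range_of_inj hginj
  rw [Module.finrank_prod, Module.finrank_prod, finrank_tangentParam, finrank_tangentParam] at h1
  refine le_trans ?_ (Submodule.finrank_mono hrange)
  omega

end LowerBound

section Nondefective

variable {K : Type*} [Field K] {k : ℕ} {n : Fin k → ℕ}

theorem tensorCoord_segreTangentMap_of_eq_one {v : ∀ i, Fin (n i + 1) → K}
    {d x : ∀ i, Fin (n i + 1)} (hx : ∀ i, v i (x i) = 1) (c : TangentParam K n d) :
    tensorCoord K n (segreTangentMap K n v d c) x =
      c.1 + ∑ i, (c.2 i : Fin (n i + 1) → K) (x i) := by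
  simp [tensorCoord_segreTangentMap, hx]

theorem tensorCoord_segreTangentMap_of_eq_zero {v : ∀ i, Fin (n i + 1) → K}
    {d x : ∀ i, Fin (n i + 1)} {i : Fin k} (hi : v i (x i) = 0)
    (hx : ∀ j, j ≠ i → v j (x j) = 1) (c : TangentParam K n d) :
    tensorCoord K n (segreTangentMap K n v d c) x = (c.2 i : Fin (n i + 1) → K) (x i) := by
  rw [tensorCoord_segreTangentMap, Finset.prod_eq_zero (Finset.mem_univ i) hi, mul_zero, zero_add,
    Finset.sum_eq_single i]
  · rw [Finset.prod_eq_one, mul_one]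
    exact fun j hj => hx j (Finset.ne_of_mem_erase hj)
  · intro j _ hj
    rw [Finset.prod_eq_zero (Finset.mem_erase.2 ⟨hj.symm, Finset.mem_univ i⟩) hi, mul_zero]
  · simp

theorem tangentParam_eq_zero_of_far {v : ∀ i, Fin (n i + 1) → K} {P : (∀ i, Fin (n i + 1)) → Prop}
    {δ : ∀ i, Fin (n i + 1)} (hcore : ∃ x, P x ∧ ∀ i, v i (x i) = 1)
    (hdir : ∀ i m, m ≠ δ i → ∃ x, x i = m ∧ P x ∧ (∀ j, j ≠ i → v j (x j) = 1) ∧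
      (v i m = 0 ∨ v i m = 1 ∧ v i (δ i) = 1 ∧ P (Function.update x i (δ i))))
    (c : TangentParam K n δ)
    (h : ∀ x, P x → tensorCoord K n (segreTangentMap K n v δ c) x = 0) : c = 0 := by
  have h2 : ∀ i m, (c.2 i : Fin (n i + 1) → K) m = 0 := by
    intro i m
    by_cases hm : m = δ i
    · rw [hm, tangentParam_coe_apply]
    obtain ⟨x, rfl, hP, hx, h0 | ⟨h1, hδ, hP'⟩⟩ := hdir i m hm
    · rw [← tensorCoord_segreTangentMap_of_eq_zero h0 hx]
      exact h x hP
    · have e1 := h x hP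
      have e2 := h _ hP'
      rw [tensorCoord_segreTangentMap_of_eq_one, ← Finset.add_sum_erase _ _ (Finset.mem_univ i)]
        at e1 e2
      · rw [Function.update_self, tangentParam_coe_apply] at e2
        have e3 : ∑ j ∈ Finset.univ.erase i,
            (c.2 j : Fin (n j + 1) → K) (Function.update x i (δ i) j) =
            ∑ j ∈ Finset.univ.erase i, (c.2 j : Fin (n j + 1) → K) (x j) :=
          Finset.sum_congr rfl fun j hj => by
            rw [Function.update_of_ne (Finset.ne_of_mem_erase hj)]
        rw [e3] at e2
        linear_combination e1 - e2
      · intro j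
        by_cases hj : j = i
        · subst hj; rwa [Function.update_self]
        · rw [Function.update_of_ne hj]; exact hx j hj
      · intro j
        by_cases hj : j = i
        · subst hj; exact h1
        · exact hx j hj
  refine tangentParam_eq_zero ?_ fun i m _ => h2 i m
  obtain ⟨x, hP, hx⟩ := hcore
  simpa [tensorCoord_segreTangentMap_of_eq_one hx, h2] using h x hP

theorem fin_zero_ne_one {m : ℕ} (h : 1 ≤ m) : (0 : Fin (m + 1)) ≠ 1 := by
  obtain ⟨m, rfl⟩ := Nat.exists_eq_add_of_le' h
  simp

theorem fin_two_ne_zero {m : ℕ} (h : 2 ≤ m) : (2 : Fin (m + 1)) ≠ 0 := by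
  obtain ⟨m, rfl⟩ := Nat.exists_eq_add_of_le' h
  simp [Fin.ext_iff, Nat.mod_eq_of_lt]

theorem fin_two_ne_one {m : ℕ} (h : 2 ≤ m) : (2 : Fin (m + 1)) ≠ 1 := by
  obtain ⟨m, rfl⟩ := Nat.exists_eq_add_of_le' h
  simp [Fin.ext_iff, Nat.mod_eq_of_lt]

variable (K n) in
/-- The point which is `e₂` in the factors in `B` and `e₀ + e₁` in the other factors. -/
def thirdPoint (B : Finset (Fin k)) : ∀ i, Fin (n i + 1) → K :=
  fun i m => if i ∈ B then (if m = 2 then 1 else 0) else (if m = 0 ∨ m = 1 then 1 else 0)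

variable (n) in
/-- A multi-index at which `thirdPoint K n B` has coordinate one. -/
def thirdIndex (B : Finset (Fin k)) : ∀ i, Fin (n i + 1) :=
  fun i => if i ∈ B then 2 else 0

theorem thirdPoint_thirdIndex (B : Finset (Fin k)) (i : Fin k) :
    thirdPoint K n B i (thirdIndex n B i) = 1 := by
  by_cases h : i ∈ B <;> simp [thirdPoint, thirdIndex, h]

variable (n) in
/-- The multi-index which is `2` on `B`, is `1` on the rest of `I` and is `0` elsewhere. -/
def coreIndex (B I : Finset (Fin k)) : ∀ i, Fin (n i + 1) :=
  fun i => if i ∈ B then 2 else if i ∈ I then 1 else 0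

theorem thirdPoint_coreIndex (B I : Finset (Fin k)) (i : Fin k) :
    thirdPoint K n B i (coreIndex n B I i) = 1 := by
  by_cases h : i ∈ B <;> by_cases h' : i ∈ I <;> simp [thirdPoint, coreIndex, h, h']

theorem coordPoint_ne_zero (d : ∀ i, Fin (n i + 1)) (i : Fin k) : coordPoint K d i ≠ 0 := by
  simp [coordPoint]

theorem threePoints_ne_zero (d e : ∀ i, Fin (n i + 1)) (B : Finset (Fin k)) (j : Fin 3)
    (i : Fin k) :
    (![coordPoint K d, coordPoint K e, thirdPoint K n B] : Fin 3 → ∀ i, Fin (n i + 1) → K) j i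
      ≠ 0 := by
  have h : thirdPoint K n B i ≠ 0 := fun h => by
    simpa [h] using thirdPoint_thirdIndex (K := K) (n := n) B i
  fin_cases j
  · exact coordPoint_ne_zero d i
  · exact coordPoint_ne_zero e i
  · exact h

/-- `T(n; 3; 0)` holds if, in every direction at `thirdPoint K n B`, there are enough
multi-indices far from both `0` and `1`. -/
theorem tHolds_three_of_far (hk : 3 ≤ k) (hpos : ∀ i, 1 ≤ n i) (B : Finset (Fin k))
    (hcore : ∃ I, FarFrom 0 (coreIndex n B I) ∧ FarFrom 1 (coreIndex n B I))
    (hB : ∀ i ∈ B, ∀ m, m ≠ 2 → ∃ I, FarFrom 0 (Function.update (coreIndex n B I) i m) ∧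
      FarFrom 1 (Function.update (coreIndex n B I) i m))
    (hA : ∀ i ∉ B, ∃ I, ∀ m, FarFrom 0 (Function.update (coreIndex n B I) i m) ∧
      FarFrom 1 (Function.update (coreIndex n B I) i m)) :
    THolds K n 3 (fun _ => 0) := by
  have hr := range_segreTangentMap (K := K) (by omega : 0 < k) (thirdPoint K n B)
    (thirdIndex n B) fun i => by simp [thirdPoint_thirdIndex]
  refine tHolds_three_of_le (by omega) _ (threePoints_ne_zero 0 1 B)
    (le_trans ?_ (le_finrank_segreTangents hk (fun i => fin_zero_ne_one (hpos i)) _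
      (segreTangentMap K n (thirdPoint K n B) (thirdIndex n B))
      (fun u => hr ▸ LinearMap.mem_range_self _ u) fun u hu =>
        tangentParam_eq_zero_of_far (P := fun x => FarFrom 0 x ∧ FarFrom 1 x) ?_ ?_ u
          fun x hx => hu x hx.1 hx.2))
  · rw [finrank_tangentParam]
    exact (min_le_left _ _).trans (by omega)
  · obtain ⟨I, hI⟩ := hcore
    exact ⟨_, hI, thirdPoint_coreIndex B I⟩
  · intro i m hm
    by_cases hi : i ∈ B
    · have hm2 : m ≠ 2 := by simpa [thirdIndex, hi] using hm
      obtain ⟨I, hI⟩ := hB i hi m hm2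
      refine ⟨_, Function.update_self _ _ _, hI, fun j hj => ?_, Or.inl ?_⟩
      · rw [Function.update_of_ne hj, thirdPoint_coreIndex]
      · simp [thirdPoint, hi, hm2]
    · obtain ⟨I, hI⟩ := hA i hi
      refine ⟨_, Function.update_self _ _ _, hI m, fun j hj => ?_, ?_⟩
      · rw [Function.update_of_ne hj, thirdPoint_coreIndex]
      · rw [Function.update_idem]
        by_cases hm1 : m = 0 ∨ m = 1
        · exact Or.inr ⟨by simp [thirdPoint, hi, hm1], thirdPoint_thirdIndex B i, hI _⟩
        · exact Or.inl (by simp [thirdPoint, hi, hm1])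

theorem exists_notMem_of_card_lt (S : Finset (Fin k)) (h : S.card < k) : ∃ a, a ∉ S := by
  by_contra! hc
  have := Finset.card_le_card (fun a _ => hc a : Finset.univ ⊆ S)
  simp at this
  omega

theorem tHolds_three_of_five_le (hk : 5 ≤ k) (hpos : ∀ i, 1 ≤ n i) :
    THolds K n 3 (fun _ => 0) := by
  have key : ∀ i : Fin k, ∃ I, ∀ m, FarFrom 0 (Function.update (coreIndex n ∅ I) i m) ∧
      FarFrom 1 (Function.update (coreIndex n ∅ I) i m) := by
    intro i
    have h01 := fun j => fin_zero_ne_one (hpos j)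
    obtain ⟨a, ha⟩ := exists_notMem_of_card_lt {i} (by rw [Finset.card_singleton]; omega)
    obtain ⟨b, hb⟩ := exists_notMem_of_card_lt {i, a} (Finset.card_le_two.trans_lt (by omega))
    obtain ⟨c, hc⟩ := exists_notMem_of_card_lt {i, a, b}
      (Finset.card_le_three.trans_lt (by omega))
    obtain ⟨e, he⟩ := exists_notMem_of_card_lt {i, a, b, c}
      (Finset.card_le_four.trans_lt (by omega))
    simp only [Finset.mem_insert, Finset.mem_singleton, not_or] at ha hb hc he
    refine ⟨{a, b}, fun m => ⟨⟨a, b, Ne.symm hb.2, ?_, ?_⟩, ⟨c, e, Ne.symm he.2.2.2, ?_, ?_⟩⟩⟩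
    · simpa [coreIndex, ha] using (h01 a).symm
    · simpa [coreIndex, hb] using (h01 b).symm
    · simpa [coreIndex, hc] using h01 c
    · simpa [coreIndex, he] using h01 e
  refine tHolds_three_of_far (by omega) hpos ∅ ?_ (by simp) fun i _ => key i
  obtain ⟨I, hI⟩ := key ⟨0, by omega⟩
  exact ⟨I, by simpa using hI (coreIndex n ∅ I ⟨0, by omega⟩)⟩

theorem tHolds_three_of_four_le (hk : 4 ≤ k) (hpos : ∀ i, 1 ≤ n i) (l : Fin k) (hl : 2 ≤ n l) :
    THolds K n 3 (fun _ => 0) := by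
  have h01 := fun j => fin_zero_ne_one (hpos j)
  have h20 := fin_two_ne_zero hl
  have h21 := fin_two_ne_one hl
  have hA : ∀ i ∉ ({l} : Finset (Fin k)), ∃ I, ∀ m,
      FarFrom 0 (Function.update (coreIndex n {l} I) i m) ∧
      FarFrom 1 (Function.update (coreIndex n {l} I) i m) := by
    intro i hi
    rw [Finset.mem_singleton] at hi
    obtain ⟨a, ha⟩ := exists_notMem_of_card_lt {i, l} (Finset.card_le_two.trans_lt (by omega))
    obtain ⟨b, hb⟩ := exists_notMem_of_card_lt {i, l, a}
      (Finset.card_le_three.trans_lt (by omega))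
    simp only [Finset.mem_insert, Finset.mem_singleton, not_or] at ha hb
    refine ⟨{a}, fun m => ⟨⟨a, l, ha.2, ?_, ?_⟩, ⟨b, l, hb.2.1, ?_, ?_⟩⟩⟩
    · simpa [coreIndex, ha] using (h01 a).symm
    · simpa [coreIndex, Ne.symm hi] using h20
    · simpa [coreIndex, hb] using h01 b
    · simpa [coreIndex, Ne.symm hi] using h21
  refine tHolds_three_of_far (by omega) hpos {l} ?_ ?_ hA
  · obtain ⟨i, hi⟩ := exists_notMem_of_card_lt {l} (by rw [Finset.card_singleton]; omega)
    obtain ⟨I, hI⟩ := hA i hi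
    exact ⟨I, by simpa using hI (coreIndex n {l} I i)⟩
  · intro i hi m hm
    obtain rfl := Finset.mem_singleton.1 hi
    obtain ⟨a, ha⟩ := exists_notMem_of_card_lt {i} (by rw [Finset.card_singleton]; omega)
    obtain ⟨b, hb⟩ := exists_notMem_of_card_lt {i, a} (Finset.card_le_two.trans_lt (by omega))
    obtain ⟨c, hc⟩ := exists_notMem_of_card_lt {i, a, b}
      (Finset.card_le_three.trans_lt (by omega))
    simp only [Finset.mem_insert, Finset.mem_singleton, not_or] at ha hb hc
    by_cases hm0 : m = 0
    · refine ⟨{a, b}, ⟨a, b, Ne.symm hb.2, ?_, ?_⟩, ⟨i, c, Ne.symm hc.1, ?_, ?_⟩⟩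
      · simpa [coreIndex, ha] using (h01 a).symm
      · simpa [coreIndex, hb] using (h01 b).symm
      · simpa [hm0] using h01 i
      · simpa [coreIndex, hc] using h01 c
    · refine ⟨{a}, ⟨i, a, Ne.symm ha, ?_, ?_⟩, ⟨b, c, Ne.symm hc.2.2, ?_, ?_⟩⟩
      · simpa using hm0
      · simpa [coreIndex, ha] using (h01 a).symm
      · simpa [coreIndex, hb] using h01 b
      · simpa [coreIndex, hc] using h01 c

theorem tHolds_three_of_two_le {n : Fin 3 → ℕ} (h0 : 1 ≤ n 0) (h1 : 2 ≤ n 1) (h2 : 2 ≤ n 2) :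
    THolds K n 3 (fun _ => 0) := by
  have hpos : ∀ i, 1 ≤ n i := fun i => by fin_cases i <;> simp <;> omega
  have hfar : ∀ x : ∀ i, Fin (n i + 1), x 1 = 2 → x 2 = 2 → FarFrom 0 x ∧ FarFrom 1 x := by
    intro x e1 e2
    exact ⟨⟨1, 2, by decide, e1 ▸ fin_two_ne_zero h1, e2 ▸ fin_two_ne_zero h2⟩,
      ⟨1, 2, by decide, e1 ▸ fin_two_ne_one h1, e2 ▸ fin_two_ne_one h2⟩⟩
  refine tHolds_three_of_far le_rfl hpos {1, 2} ⟨∅, hfar _ rfl rfl⟩ ?_ ?_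
  · intro i hi m _
    have h01 := fin_zero_ne_one h0
    obtain ⟨j, hj, hi0, hj0, hjn⟩ : ∃ j ∈ ({1, 2} : Finset (Fin 3)), i ≠ 0 ∧ j ≠ 0 ∧ j ≠ i :=
      (by decide : ∀ i ∈ ({1, 2} : Finset (Fin 3)), ∃ j ∈ ({1, 2} : Finset (Fin 3)),
        i ≠ 0 ∧ j ≠ 0 ∧ j ≠ i) i hi
    have hn : 2 ≤ n j := by
      rcases Finset.mem_insert.1 hj with rfl | hj
      · exact h1
      · rwa [Finset.mem_singleton.1 hj]
    by_cases hm0 : m = 0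
    · refine ⟨{0}, ⟨0, j, hj0.symm, ?_, ?_⟩, ⟨i, j, hjn.symm, ?_, ?_⟩⟩
      · simpa [coreIndex, hi0.symm] using h01.symm
      · simpa only [coreIndex, Function.update_of_ne hjn, if_pos hj, Pi.zero_apply]
          using fin_two_ne_zero hn
      · simpa [hm0] using fin_zero_ne_one (hpos i)
      · simpa only [coreIndex, Function.update_of_ne hjn, if_pos hj, Pi.one_apply]
          using fin_two_ne_one hn
    · refine ⟨∅, ⟨i, j, hjn.symm, ?_, ?_⟩, ⟨0, j, hj0.symm, ?_, ?_⟩⟩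
      · simpa using hm0
      · simpa only [coreIndex, Function.update_of_ne hjn, if_pos hj, Pi.zero_apply]
          using fin_two_ne_zero hn
      · simpa [coreIndex, hi0.symm] using h01
      · simpa only [coreIndex, Function.update_of_ne hjn, if_pos hj, Pi.one_apply]
          using fin_two_ne_one hn
  · intro i hi
    obtain rfl : i = 0 := by revert i; decide
    exact ⟨∅, fun m => hfar _ rfl rfl⟩

theorem tHolds_three_of_eq_one {n : Fin 3 → ℕ} (h0 : n 0 = 1) (h1 : n 1 = 1) (h2 : n 2 = 1) :
    THolds K n 3 (fun _ => 0) := by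
  have hpos : ∀ i, 1 ≤ n i := fun i => by fin_cases i <;> simp [h0, h1, h2]
  refine tHolds_three_of_le (by omega) _ (threePoints_ne_zero 0 1 ∅)
    (le_trans ?_ (le_finrank_segreTangents le_rfl (fun i => fin_zero_ne_one (hpos i)) _
      (0 : PUnit.{1} →ₗ[K] _) (fun u => zero_mem _) fun _ _ => rfl))
  simp [Fin.sum_univ_three, Fin.prod_univ_three, h0, h1, h2]

theorem tHolds_three_of_eq_two {n : Fin 3 → ℕ} (h0 : n 0 = 1) (h1 : n 1 = 1) (h2 : n 2 = 2) :
    THolds K n 3 (fun _ => 0) := by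
  have hpos : ∀ i, 1 ≤ n i := fun i => by fin_cases i <;> simp [h0, h1, h2]
  set v := thirdPoint K n {2} with hv
  have hf : ∀ u : K × K, ((LinearMap.toSpanSingleton K _ (PiTensorProduct.tprod K v)).coprod
      (LinearMap.toSpanSingleton K _
        (PiTensorProduct.tprod K (Function.update v 0 (Pi.single 1 1))))) u =
      u.1 • PiTensorProduct.tprod K v +
        u.2 • PiTensorProduct.tprod K (Function.update v 0 (Pi.single 1 1)) := fun u => by simp
  refine tHolds_three_of_le (by omega) _ (threePoints_ne_zero 0 1 {2})
    (le_trans ?_ (le_finrank_segreTangents le_rfl (fun i => fin_zero_ne_one (hpos i)) v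
      ((LinearMap.toSpanSingleton K _ (PiTensorProduct.tprod K v)).coprod
      (LinearMap.toSpanSingleton K _
        (PiTensorProduct.tprod K (Function.update v 0 (Pi.single 1 1))))) ?_ ?_))
  · simp [Fin.sum_univ_three, Fin.prod_univ_three, h0, h1, h2]
  · intro u
    rw [hf]
    refine add_mem (Submodule.smul_mem _ _ ?_)
      (Submodule.smul_mem _ _ (tprod_update_mem_segreTangent _ _ _))
    simpa using tprod_update_mem_segreTangent v 0 (v 0)
  · intro u h
    have h01 := fun i => fin_zero_ne_one (hpos i)
    have h20 : (2 : Fin (n 2 + 1)) ≠ 0 := fin_two_ne_zero h2.ge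
    have h21 : (2 : Fin (n 2 + 1)) ≠ 1 := fin_two_ne_one h2.ge
    have e1 := h (coreIndex n {2} {1}) ⟨1, 2, by decide, by simpa [coreIndex] using (h01 1).symm, by simpa [coreIndex] using h20⟩
      ⟨0, 2, by decide, by simpa [coreIndex] using h01 0,
        by simpa [coreIndex] using h21⟩
    have e2 := h (coreIndex n {2} {0}) ⟨0, 2, by decide, by simpa [coreIndex] using (h01 0).symm, by simpa [coreIndex] using h20⟩
      ⟨1, 2, by decide, by simpa [coreIndex] using h01 1,
        by simpa [coreIndex] using h21⟩
    rw [hf] at e1 e2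
    simp only [map_add, map_smul, Pi.add_apply, Pi.smul_apply, tensorCoord_tprod,
      thirdPoint_coreIndex, hv] at e1 e2
    simp [Fin.prod_univ_three, coreIndex, thirdPoint, h01 0] at e1 e2
    exact Prod.ext e1 (by simpa [e1] using e2)

end Nondefective

section Contraction

variable {K : Type*} [Field K] {k : ℕ} {n : Fin (k + 1) → ℕ}

/-- Contraction of all tensor factors other than `i` against the array `φ`. -/
noncomputable def contractAway (i : Fin (k + 1))
    (φ : (∀ l, Fin (n (i.succAbove l) + 1)) → K) :
    (⨂[K] i, (Fin (n i + 1) → K)) →ₗ[K] (Fin (n i + 1) → K) :=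
  LinearMap.pi fun m => ∑ y, φ y • (LinearMap.proj (i.insertNth m y) ∘ₗ
    (tensorCoord K n).toLinearMap)

theorem contractAway_apply (i : Fin (k + 1)) (φ : (∀ l, Fin (n (i.succAbove l) + 1)) → K)
    (t : ⨂[K] i, (Fin (n i + 1) → K)) (m : Fin (n i + 1)) :
    contractAway i φ t m = ∑ y, φ y * tensorCoord K n t (i.insertNth m y) := by
  simp [contractAway]

theorem contractAway_tprod (i : Fin (k + 1)) (φ : (∀ l, Fin (n (i.succAbove l) + 1)) → K)
    (w : ∀ i, Fin (n i + 1) → K) :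
    contractAway i φ (PiTensorProduct.tprod K w) =
      (∑ y, φ y * ∏ l, w (i.succAbove l) (y l)) • w i := by
  ext m
  simp only [contractAway_apply, tensorCoord_tprod, Fin.prod_univ_succAbove _ i,
    Fin.insertNth_apply_same, Fin.insertNth_apply_succAbove, Pi.smul_apply, smul_eq_mul,
    Finset.sum_mul]
  exact Finset.sum_congr rfl fun y _ => by ring

theorem contractAway_surjective (i : Fin (k + 1))
    {φ : (∀ l, Fin (n (i.succAbove l) + 1)) → K} (hφ : φ ≠ 0) :
    Function.Surjective (contractAway i φ) := by
  obtain ⟨z, hz⟩ := Function.ne_iff.1 hφ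
  intro g
  refine ⟨(tensorCoord K n).symm fun x =>
    if i.removeNth x = z then g (x i) / φ z else 0, ?_⟩
  ext m
  have hz' : φ z ≠ 0 := hz
  rw [contractAway_apply, Finset.sum_eq_single z]
  · simp [mul_div_cancel₀, hz']
  · intro y _ hy
    simp [hy]
  · simp

theorem finrank_segreTangents_add_le_of_three_lt (i : Fin (k + 1))
    (h : 3 < ∏ l, (n (i.succAbove l) + 1)) (p : Fin 3 → ∀ i, Fin (n i + 1) → K) :
    Module.finrank K (⨆ j, segreTangent K n (p j) : Submodule K _) + (n i + 1) ≤
      (∏ i, (n i + 1)) + 3 := by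
  obtain ⟨φ, hφ, hφ0⟩ : ∃ φ : (∀ l, Fin (n (i.succAbove l) + 1)) → K,
      (∀ j, ∑ y, φ y * ∏ l, p j (i.succAbove l) (y l) = 0) ∧ φ ≠ 0 := by
    let f : ((∀ l, Fin (n (i.succAbove l) + 1)) → K) →ₗ[K] (Fin 3 → K) :=
      LinearMap.pi fun j => ∑ y, (∏ l, p j (i.succAbove l) (y l)) • LinearMap.proj y
    have hf : LinearMap.ker f ≠ ⊥ := LinearMap.ker_ne_bot_of_finrank_lt (by simpa using h)
    obtain ⟨φ, hφ, hφ0⟩ := Submodule.exists_mem_ne_zero_of_ne_bot hf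
    refine ⟨φ, fun j => ?_, hφ0⟩
    have := congrFun (LinearMap.mem_ker.1 hφ) j
    simpa [f, mul_comm] using this
  have hle := finrank_add_le_of_le_comap (contractAway i φ) (contractAway_surjective i hφ0)
    (⨆ j, segreTangent K n (p j)) (Submodule.span K (Set.range fun j => p j i)) (by
      refine iSup_le fun j => iSup_le fun l => ?_
      rintro _ ⟨w, rfl⟩
      rw [Submodule.mem_comap, MultilinearMap.toLinearMap_apply, contractAway_tprod]
      by_cases hl : l = i
      · subst hl
        simp [hφ j]
      · rw [Function.update_of_ne (Ne.symm hl)]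
        exact Submodule.smul_mem _ _ (Submodule.subset_span ⟨j, rfl⟩))
  have hS : Module.finrank K (Submodule.span K (Set.range fun j => p j i)) ≤ 3 := by
    simpa [Set.finrank] using finrank_range_le_card (R := K) fun j => p j i
  rw [finrank_tensor, Module.finrank_fin_fun] at hle
  omega

/-- Contraction of the tensor factor `i` against the vector `α`. -/
noncomputable def contractAt (i : Fin (k + 1)) (α : Fin (n i + 1) → K) :
    (⨂[K] i, (Fin (n i + 1) → K)) →ₗ[K] (⨂[K] l, (Fin (n (i.succAbove l) + 1) → K)) :=
  (tensorCoord K fun l => n (i.succAbove l)).symm.toLinearMap ∘ₗ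
    LinearMap.pi fun y => ∑ m, α m • (LinearMap.proj (i.insertNth m y) ∘ₗ
      (tensorCoord K n).toLinearMap)

theorem tensorCoord_contractAt (i : Fin (k + 1)) (α : Fin (n i + 1) → K)
    (t : ⨂[K] i, (Fin (n i + 1) → K)) (y : ∀ l, Fin (n (i.succAbove l) + 1)) :
    tensorCoord K (fun l => n (i.succAbove l)) (contractAt i α t) y =
      ∑ m, α m * tensorCoord K n t (i.insertNth m y) := by
  simp [contractAt]

theorem contractAt_tprod (i : Fin (k + 1)) (α : Fin (n i + 1) → K)
    (w : ∀ i, Fin (n i + 1) → K) :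
    contractAt i α (PiTensorProduct.tprod K w) =
      (∑ m, α m * w i m) • PiTensorProduct.tprod K (i.removeNth w) := by
  apply (tensorCoord K fun l => n (i.succAbove l)).injective
  ext y
  simp only [tensorCoord_contractAt, map_smul, tensorCoord_tprod, Fin.prod_univ_succAbove _ i,
    Fin.insertNth_apply_same, Fin.insertNth_apply_succAbove, Pi.smul_apply, smul_eq_mul,
    Finset.sum_mul, Fin.removeNth]
  exact Finset.sum_congr rfl fun y _ => by ring

theorem contractAt_surjective (i : Fin (k + 1)) {α : Fin (n i + 1) → K} (hα : α ≠ 0) :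
    Function.Surjective (contractAt i α) := by
  obtain ⟨z, hz⟩ := Function.ne_iff.1 hα
  have hz' : α z ≠ 0 := hz
  intro g
  refine ⟨(tensorCoord K n).symm fun x =>
    if x i = z then tensorCoord K (fun l => n (i.succAbove l)) g (i.removeNth x) / α z else 0, ?_⟩
  apply (tensorCoord K fun l => n (i.succAbove l)).injective
  ext y
  rw [tensorCoord_contractAt, Finset.sum_eq_single z]
  · simp [mul_div_cancel₀, hz']
  · intro m _ hm
    simp [hm]
  · simp

theorem finrank_segreTangents_add_le_of_contractAt (hk : 0 < k) (i : Fin (k + 1))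
    {α : Fin (n i + 1) → K} (hα : α ≠ 0) (p : Fin 3 → ∀ i, Fin (n i + 1) → K)
    (hp : ∀ j i, p j i ≠ 0) (c : Fin 3) (h : ∀ j, j ≠ c → ∑ m, α m * p j i m = 0) :
    Module.finrank K (⨆ j, segreTangent K n (p j) : Submodule K _) +
        ∏ l, (n (i.succAbove l) + 1) ≤
      (∏ i, (n i + 1)) + (2 + (1 + ∑ l, n (i.succAbove l))) := by
  set S := Submodule.span K (Set.range fun j : {j // j ≠ c} =>
    PiTensorProduct.tprod K (i.removeNth (p j)))
  set T := segreTangent K (fun l => n (i.succAbove l)) (i.removeNth (p c))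
  have hle := finrank_add_le_of_le_comap (contractAt i α) (contractAt_surjective i hα)
    (⨆ j, segreTangent K n (p j)) (S ⊔ T) (by
      refine iSup_le fun j => iSup_le fun l => ?_
      rintro _ ⟨w, rfl⟩
      rw [Submodule.mem_comap, MultilinearMap.toLinearMap_apply, contractAt_tprod]
      by_cases hl : l = i
      · subst hl
        rw [Fin.removeNth_update]
        refine Submodule.smul_mem _ _ ?_
        by_cases hj : j = c
        · subst hj
          refine Submodule.mem_sup_right ?_
          simpa using tprod_update_mem_segreTangent (n := fun m => n (l.succAbove m))
            (l.removeNth (p j)) ⟨0, hk⟩ (l.removeNth (p j) ⟨0, hk⟩)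
        · exact Submodule.mem_sup_left (Submodule.subset_span ⟨⟨j, hj⟩, rfl⟩)
      · obtain ⟨l, rfl⟩ := Fin.exists_succAbove_eq hl
        rw [Function.update_of_ne (Ne.symm hl)]
        by_cases hj : j = c
        · subst hj
          rw [Fin.removeNth_update_succAbove]
          exact Submodule.smul_mem _ _ (Submodule.mem_sup_right
            (tprod_update_mem_segreTangent _ _ _))
        · rw [h j hj, zero_smul]
          exact zero_mem _)
  have hS : Module.finrank K S ≤ 2 := by
    simpa [Set.finrank, S, Fintype.card_subtype_compl] using
      finrank_range_le_card (R := K) fun j : {j // j ≠ c} =>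
        PiTensorProduct.tprod K (i.removeNth (p j))
  have hT : Module.finrank K T ≤ 1 + ∑ l, n (i.succAbove l) :=
    finrank_segreTangent_le hk _ fun l => hp c _
  have hST := Submodule.finrank_add_le_finrank_add_finrank S T
  rw [finrank_tensor, finrank_tensor] at hle
  omega

end Contraction

section FourLines

variable {K : Type*} [Field K]

/-- The determinant of two vectors in the plane. -/
def bracket (u v : Fin 2 → K) : K := u 0 * v 1 - u 1 * v 0

/-- A bilinear form in the factors `i` and `l` that vanishes at the three given points. -/
def pairForm (p : Fin 3 → Fin 4 → Fin 2 → K) (i l : Fin 4) (x y : Fin 2 → K) : K :=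
  bracket (p 1 i) (p 2 i) * bracket (p 0 l) (p 2 l) * (bracket (p 0 i) x * bracket (p 1 l) y) -
    bracket (p 0 i) (p 2 i) * bracket (p 1 l) (p 2 l) * (bracket (p 1 i) x * bracket (p 0 l) y)

theorem pairForm_self (p : Fin 3 → Fin 4 → Fin 2 → K) (i l : Fin 4) (j : Fin 3) :
    pairForm p i l (p j i) (p j l) = 0 := by
  fin_cases j <;> simp [pairForm, bracket] <;> ring

theorem pairForm_zero_one (p : Fin 3 → Fin 4 → Fin 2 → K) (i l : Fin 4) :
    pairForm p i l (p 0 i) (p 1 l) = bracket (p 0 i) (p 2 i) * bracket (p 1 l) (p 2 l) *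
      (bracket (p 0 i) (p 1 i) * bracket (p 0 l) (p 1 l)) := by
  simp [pairForm, bracket]
  ring

theorem pairForm_add_left (p : Fin 3 → Fin 4 → Fin 2 → K) (i l : Fin 4) (x x' y : Fin 2 → K) :
    pairForm p i l (x + x') y = pairForm p i l x y + pairForm p i l x' y := by
  simp only [pairForm, bracket, Pi.add_apply]
  ring

theorem pairForm_add_right (p : Fin 3 → Fin 4 → Fin 2 → K) (i l : Fin 4) (x y y' : Fin 2 → K) :
    pairForm p i l x (y + y') = pairForm p i l x y + pairForm p i l x y' := by
  simp only [pairForm, bracket, Pi.add_apply]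
  ring

theorem pairForm_smul_left (p : Fin 3 → Fin 4 → Fin 2 → K) (i l : Fin 4) (c : K)
    (x y : Fin 2 → K) : pairForm p i l (c • x) y = c * pairForm p i l x y := by
  simp only [pairForm, bracket, Pi.smul_apply, smul_eq_mul]
  ring

theorem pairForm_smul_right (p : Fin 3 → Fin 4 → Fin 2 → K) (i l : Fin 4) (c : K)
    (x y : Fin 2 → K) : pairForm p i l x (c • y) = c * pairForm p i l x y := by
  simp only [pairForm, bracket, Pi.smul_apply, smul_eq_mul]
  ring

/-- The product of the forms `pairForm` for the pairs of factors `{0, l}` and `{s, 3}`. -/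
def doubleForm (p : Fin 3 → Fin 4 → Fin 2 → K) (l s : Fin 4)
    (h : l = 1 ∧ s = 2 ∨ l = 2 ∧ s = 1) :
    MultilinearMap K (fun _ : Fin 4 => Fin 2 → K) K :=
  MultilinearMap.mk' (fun w => pairForm p 0 l (w 0) (w l) * pairForm p s 3 (w s) (w 3))
    (by
      intro w i x y
      rcases h with ⟨rfl, rfl⟩ | ⟨rfl, rfl⟩ <;> fin_cases i <;>
        simp [Function.update_of_ne, pairForm_add_left, pairForm_add_right, add_mul, mul_add])
    (by
      intro w i c x
      rcases h with ⟨rfl, rfl⟩ | ⟨rfl, rfl⟩ <;> fin_cases i <;>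
        simp [Function.update_of_ne, pairForm_smul_left, pairForm_smul_right, mul_assoc,
          mul_left_comm])

theorem doubleForm_apply (p : Fin 3 → Fin 4 → Fin 2 → K) (l s : Fin 4)
    (h : l = 1 ∧ s = 2 ∨ l = 2 ∧ s = 1) (w : Fin 4 → Fin 2 → K) :
    doubleForm p l s h w = pairForm p 0 l (w 0) (w l) * pairForm p s 3 (w s) (w 3) :=
  rfl

theorem doubleForm_update (p : Fin 3 → Fin 4 → Fin 2 → K) (l s : Fin 4)
    (h : l = 1 ∧ s = 2 ∨ l = 2 ∧ s = 1) (j : Fin 3) (i : Fin 4) (u : Fin 2 → K) :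
    doubleForm p l s h (Function.update (p j) i u) = 0 := by
  rw [doubleForm_apply]
  by_cases hi : i = 0 ∨ i = l
  · have h1 : s ≠ i := by rcases h with ⟨rfl, rfl⟩ | ⟨rfl, rfl⟩ <;> revert i <;> decide
    have h2 : 3 ≠ i := by rcases h with ⟨rfl, rfl⟩ | ⟨rfl, rfl⟩ <;> revert i <;> decide
    rw [Function.update_of_ne h1, Function.update_of_ne h2, pairForm_self, mul_zero]
  · push Not at hi
    rw [Function.update_of_ne hi.1.symm, Function.update_of_ne hi.2.symm, pairForm_self, zero_mul]

theorem finrank_segreTangents_four_of_bracket_ne_zero (p : Fin 3 → Fin 4 → Fin 2 → K)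
    (h : ∀ j j' i, j < j' → bracket (p j i) (p j' i) ≠ 0) :
    Module.finrank K (⨆ j, segreTangent K (fun _ : Fin 4 => 1) (p j) : Submodule K _) + 2 ≤ 16 := by
  let f := (PiTensorProduct.lift (doubleForm p 1 2 (by simp))).prod
    (PiTensorProduct.lift (doubleForm p 2 1 (by simp)))
  have hf : ∀ w : Fin 4 → Fin 2 → K, f (PiTensorProduct.tprod K w) =
      (doubleForm p 1 2 (by simp) w, doubleForm p 2 1 (by simp) w) := fun w => by
    simp [f]
  have hne : ∀ i l, pairForm p i l (p 0 i) (p 1 l) ≠ 0 := fun i l => by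
    rw [pairForm_zero_one]
    exact mul_ne_zero (mul_ne_zero (h _ _ _ (by decide)) (h _ _ _ (by decide)))
      (mul_ne_zero (h _ _ _ (by decide)) (h _ _ _ (by decide)))
  have hsurj : Function.Surjective f := by
    rintro ⟨a, b⟩
    have e1 := hf ![p 0 0, p 1 1, p 0 2, p 1 3]
    have e2 := hf ![p 0 0, p 0 1, p 1 2, p 1 3]
    simp only [doubleForm_apply] at e1 e2
    simp [pairForm_self] at e1 e2
    refine ⟨(a / (pairForm p 0 1 (p 0 0) (p 1 1) * pairForm p 2 3 (p 0 2) (p 1 3))) •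
        PiTensorProduct.tprod K ![p 0 0, p 1 1, p 0 2, p 1 3] +
      (b / (pairForm p 0 2 (p 0 0) (p 1 2) * pairForm p 1 3 (p 0 1) (p 1 3))) •
        PiTensorProduct.tprod K ![p 0 0, p 0 1, p 1 2, p 1 3], ?_⟩
    rw [map_add, map_smul, map_smul]
    erw [e1, e2]
    simp [hne]
  have hle := finrank_add_le_of_le_comap f hsurj
    (⨆ j, segreTangent K (fun _ : Fin 4 => 1) (p j)) ⊥ (by
      refine iSup_le fun j => iSup_le fun i => ?_
      rintro _ ⟨u, rfl⟩
      rw [Submodule.mem_comap, MultilinearMap.toLinearMap_apply, Submodule.mem_bot, hf,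
        doubleForm_update, doubleForm_update]
      rfl)
  rw [finrank_tensor, finrank_bot] at hle
  simpa using hle

theorem finrank_segreTangents_four_le (p : Fin 3 → Fin 4 → Fin 2 → K) (hp : ∀ j i, p j i ≠ 0) :
    Module.finrank K (⨆ j, segreTangent K (fun _ : Fin 4 => 1) (p j) : Submodule K _) + 2 ≤ 16 := by
  by_cases h : ∀ j j' i, j < j' → bracket (p j i) (p j' i) ≠ 0
  · exact finrank_segreTangents_four_of_bracket_ne_zero p h
  push Not at h
  obtain ⟨a, b, i, hab, h0⟩ := h
  obtain ⟨c, hc⟩ : ∃ c, ∀ j, j ≠ c → j = a ∨ j = b :=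
    (by decide : ∀ a b : Fin 3, a < b → ∃ c, ∀ j, j ≠ c → j = a ∨ j = b) a b hab
  have hα : (![-p a i 1, p a i 0] : Fin 2 → K) ≠ 0 := by
    intro hα
    have e0 := congrFun hα 0
    have e1 := congrFun hα 1
    apply hp a i
    ext m
    fin_cases m
    · simpa using e1
    · simpa using e0
  have hle := finrank_segreTangents_add_le_of_contractAt (n := fun _ : Fin 4 => 1) (by omega) i hα
    p hp c fun j hj => by
      rw [Fin.sum_univ_two]
      rcases hc j hj with rfl | rfl
      · simp; ring
      · rw [bracket] at h0
        simp
        linear_combination h0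
  have e8 : ∏ l : Fin 3, ((fun _ : Fin 4 => 1) (i.succAbove l) + 1) = 8 := by simp
  have e16 : ∏ l : Fin 4, ((fun _ : Fin 4 => 1) l + 1) = 16 := by simp
  have e3 : ∑ l : Fin 3, (fun _ : Fin 4 => 1) (i.succAbove l) = 3 := by simp
  rw [e8, e16, e3] at hle
  exact Nat.le_of_add_le_add_right (b := 6) hle

end FourLines

/-- classification of defective 3-secant varieties.  Let `k ≥ 3` and
`1 ≤ n₁ ≤ ⋯ ≤ n_k`.  Then `T(n; 3; 0,…,0)` holds unless `(n₁,…,n_k) = (1,1,a)` with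
`a ≥ 3` or `(n₁,…,n_k) = (1,1,1,1)`, and in these exceptional cases it fails. -/
theorem secant3_classification
    (K : Type*) [Field K] [CharZero K] {k : ℕ} (hk : 3 ≤ k)
    (n : Fin k → ℕ) (hmono : Monotone n) (hpos : ∀ i, 1 ≤ n i) :
    (¬ ((k = 3 ∧ n ⟨0, by omega⟩ = 1 ∧ n ⟨1, by omega⟩ = 1 ∧ 3 ≤ n ⟨2, by omega⟩) ∨
        (k = 4 ∧ ∀ i, n i = 1)) →
      THolds K n 3 (fun _ => 0)) ∧
    (((k = 3 ∧ n ⟨0, by omega⟩ = 1 ∧ n ⟨1, by omega⟩ = 1 ∧ 3 ≤ n ⟨2, by omega⟩) ∨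
        (k = 4 ∧ ∀ i, n i = 1)) →
      TFails K n 3 (fun _ => 0)) := by
  refine ⟨fun h => ?_, ?_⟩
  · push Not at h
    obtain ⟨h3, h4⟩ := h
    obtain rfl | rfl | hk5 : k = 3 ∨ k = 4 ∨ 5 ≤ k := by omega
    · have h01 : n 0 ≤ n 1 := hmono (by decide)
      have h12 : n 1 ≤ n 2 := hmono (by decide)
      have h0 := hpos 0
      have h1 := hpos 1
      have h2 := hpos 2
      by_cases h1' : 2 ≤ n 1
      · exact tHolds_three_of_two_le h0 h1' (h1'.trans h12)
      · have h3' : n 2 < 3 := h3 rfl (show n 0 = 1 by omega) (show n 1 = 1 by omega)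
        obtain e | e : n 2 = 1 ∨ n 2 = 2 := by omega
        · exact tHolds_three_of_eq_one (by omega) (by omega) e
        · exact tHolds_three_of_eq_two (by omega) (by omega) e
    · obtain ⟨l, hl⟩ := h4 rfl
      have := hpos l
      exact tHolds_three_of_four_le le_rfl hpos l (by omega)
    · exact tHolds_three_of_five_le hk5 hpos
  · rintro (⟨rfl, h0, h1, h2⟩ | ⟨rfl, h⟩)
    · replace h0 : n 0 = 1 := h0
      replace h1 : n 1 = 1 := h1
      replace h2 : 3 ≤ n 2 := h2
      have hprod : ∏ l : Fin 2, (n ((2 : Fin 3).succAbove l) + 1) = 4 := by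
        rw [Fin.prod_univ_two]
        change (n 0 + 1) * (n 1 + 1) = 4
        rw [h0, h1]
      refine tFails_three_of_lt fun p _ => ?_
      have hle : Module.finrank K (⨆ j, segreTangent K n (p j) : Submodule K _) + (n 2 + 1) ≤
          (∏ i, (n i + 1)) + 3 :=
        finrank_segreTangents_add_le_of_three_lt (2 : Fin 3) (by omega) p
      rw [Fin.prod_univ_three, h0, h1] at hle
      rw [Fin.sum_univ_three, Fin.prod_univ_three, h0, h1, lt_min_iff]
      omega
    · obtain rfl : n = fun _ => 1 := funext h
      refine tFails_three_of_lt fun p hp => ?_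
      have hle := finrank_segreTangents_four_le p hp
      have hs : ∑ _i : Fin 4, 1 = 4 := by simp
      have hr : ∏ _i : Fin 4, (1 + 1) = 16 := by simp
      rw [hs, hr, lt_min_iff]
      omega
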